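/- arXiv:1904.08312 — 2 statements merged into one kernel-verified Lean document; each statement's English description precedes it below -/
import Mathlib

section
/- If u is continuous on the closure of a bounded domain D in which the Dirichlet problem for the Laplace equation has a continuous-up-to-the-boundary solution for every continuous boundary data, and u has the restricted mean value property with respect to spheres (for each x ∈ D there exists r(x) > 0 with closure of B_{r(x)}(x) ⊂ D and u(x) equal to the spherical mean of u over ∂B_{r(x)}(x)), then u is harmonic in D. -/
open MeasureTheory Metric Real

noncomputable section

/-- The Laplacian of `u : ℝ^m → ℝ` as the sum of second partial derivatives. -/
def lap {m : ℕ} (u : EuclideanSpace ℝ (Fin m) → ℝ) (x : EuclideanSpace ℝ (Fin m)) : ℝ :=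
  ∑ i : Fin m,
    fderiv ℝ (fun y => fderiv ℝ u y (EuclideanSpace.single i 1)) x (EuclideanSpace.single i 1)

/-- `u` is harmonic on `s`: it is `C²` there and its Laplacian vanishes. -/
def IsHarmonicOn {m : ℕ} (u : EuclideanSpace ℝ (Fin m) → ℝ)
    (s : Set (EuclideanSpace ℝ (Fin m))) : Prop :=
  ContDiffOn ℝ 2 u s ∧ ∀ x ∈ s, lap u x = 0

/-- Average of `u` over the sphere `∂B_r(x)` w.r.t. the `(m-1)`-dimensional
Hausdorff (surface) measure. -/
def sphAvg {m : ℕ} (u : EuclideanSpace ℝ (Fin m) → ℝ) (x : EuclideanSpace ℝ (Fin m))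
    (r : ℝ) : ℝ :=
  ((μH[(m : ℝ) - 1] (sphere x r)).toReal)⁻¹ * ∫ y in sphere x r, u y ∂(μH[(m : ℝ) - 1])

/-- Average of `u` over the open ball `B_r(x)` w.r.t. Lebesgue measure. -/
def ballAvg {m : ℕ} (u : EuclideanSpace ℝ (Fin m) → ℝ) (x : EuclideanSpace ℝ (Fin m))
    (r : ℝ) : ℝ :=
  ((volume (ball x r)).toReal)⁻¹ * ∫ y in ball x r, u y

/-- The volume `ω_m` of the unit ball in `ℝ^m`. -/
def unitBallVol (m : ℕ) : ℝ := (volume (ball (0 : EuclideanSpace ℝ (Fin m)) 1)).toReal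

theorem aux_finrank {m : ℕ} (hm : 2 ≤ m) {p : EuclideanSpace ℝ (Fin m)} (hp : p ≠ 0) :
    (Module.finrank ℝ (ℝ ∙ p)ᗮ : ℝ) = (m : ℝ) - 1 := by
  have : Fact (Module.finrank ℝ (EuclideanSpace ℝ (Fin m)) = (m - 1) + 1) :=
    ⟨by rw [finrank_euclideanSpace_fin]; omega⟩
  rw [Submodule.finrank_orthogonal_span_singleton (n := m - 1) hp]
  rw [Nat.cast_sub (by omega)]; simp

theorem aux_haar {m : ℕ} (hm : 2 ≤ m) {p : EuclideanSpace ℝ (Fin m)} (hp : p ≠ 0) :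
    (μH[(m : ℝ) - 1] : Measure (ℝ ∙ p)ᗮ).IsAddHaarMeasure := by
  rw [← aux_finrank hm hp]; infer_instance

/-- graph parametrization of the sphere near `p` -/
def gr {m : ℕ} (p : EuclideanSpace ℝ (Fin m)) (r : ℝ) (z : (ℝ ∙ p)ᗮ) :
    EuclideanSpace ℝ (Fin m) := (z : EuclideanSpace ℝ (Fin m)) + √(1 - ‖z‖ ^ 2 / r ^ 2) • p

theorem gr_zero {m : ℕ} (p : EuclideanSpace ℝ (Fin m)) (r : ℝ) : gr p r 0 = p := by
  simp [gr]

theorem gr_contDiffAt {m : ℕ} (p : EuclideanSpace ℝ (Fin m)) (r : ℝ) :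
    ContDiffAt ℝ 1 (gr p r) 0 := by
  unfold gr
  refine ContDiffAt.add (Submodule.subtypeL (ℝ ∙ p)ᗮ).contDiff.contDiffAt
    (ContDiffAt.smul (ContDiffAt.sqrt ?_ (by simp)) contDiffAt_const)
  exact (contDiff_const.sub ((contDiff_norm_sq ℝ).div_const _)).contDiffAt

theorem gr_proj {m : ℕ} (p : EuclideanSpace ℝ (Fin m)) (r : ℝ) (z : (ℝ ∙ p)ᗮ) :
    (ℝ ∙ p)ᗮ.orthogonalProjectionOnto (gr p r z) = z := by
  have h : (ℝ ∙ p)ᗮ.orthogonalProjectionOnto p = 0 := by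
    rw [Submodule.orthogonalProjectionOnto_eq_zero_iff]
    exact Submodule.le_orthogonal_orthogonal _ (Submodule.mem_span_singleton_self p)
  simp [gr, h]

theorem gr_mem {m : ℕ} {p : EuclideanSpace ℝ (Fin m)} {r : ℝ} (hr : 0 < r) (hp : ‖p‖ = r)
    {z : (ℝ ∙ p)ᗮ} (hz : ‖z‖ ≤ r) : ‖gr p r z‖ = r := by
  have h0 : inner ℝ (z : EuclideanSpace ℝ (Fin m)) p = 0 := by
    have := z.2
    rwa [Submodule.mem_orthogonal_singleton_iff_inner_left] at this
  have h1 : ‖z‖ ^ 2 / r ^ 2 ≤ 1 := by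
    rw [div_le_one (by positivity)]; gcongr
  have h2 : ‖gr p r z‖ ^ 2 = r ^ 2 := by
    rw [gr, norm_add_sq_real, inner_smul_right, h0, norm_smul, mul_pow, hp, Real.norm_eq_abs, sq_abs,
      Real.sq_sqrt (by linarith)]
    rw [Submodule.coe_norm] at *
    field_simp
    ring
  exact (pow_left_inj₀ (norm_nonneg _) hr.le two_ne_zero).1 h2

theorem gr_inv {m : ℕ} {p : EuclideanSpace ℝ (Fin m)} {r : ℝ} (hr : 0 < r) (hp : ‖p‖ = r)
    {y : EuclideanSpace ℝ (Fin m)} (hy : ‖y‖ = r) (hpos : 0 < inner ℝ p y) :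
    gr p r ((ℝ ∙ p)ᗮ.orthogonalProjectionOnto y) = y := by
  set z := (ℝ ∙ p)ᗮ.orthogonalProjectionOnto y with hz
  have h0 : inner ℝ (z : EuclideanSpace ℝ (Fin m)) p = 0 := by
    have := z.2
    rwa [Submodule.mem_orthogonal_singleton_iff_inner_left] at this
  have hd : y = (z : EuclideanSpace ℝ (Fin m)) + (inner ℝ p y / r ^ 2) • p := by
    have := Submodule.starProjection_add_starProjection_orthogonal (K := ℝ ∙ p) y
    rw [Submodule.starProjection_singleton, hp] at this
    conv_lhs => rw [← this]
    rw [add_comm]; rfl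
  have h3 : ‖y‖ ^ 2 = ‖z‖ ^ 2 + (inner ℝ p y / r ^ 2) ^ 2 * r ^ 2 := by
    conv_lhs => rw [hd]
    rw [norm_add_sq_real, inner_smul_right, h0, norm_smul, mul_pow, hp, Real.norm_eq_abs, sq_abs,
      Submodule.coe_norm]
    ring
  have h4 : √(1 - ‖z‖ ^ 2 / r ^ 2) = inner ℝ p y / r ^ 2 := by
    rw [← Real.sqrt_sq (show 0 ≤ inner ℝ p y / r ^ 2 by positivity)]
    congr 1
    rw [hy] at h3
    have : ‖z‖ ^ 2 = r ^ 2 - (inner ℝ p y / r ^ 2) ^ 2 * r ^ 2 := by linarith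
    rw [this]
    field_simp
    ring
  rw [gr, h4, ← hd]

theorem sph_finite {m : ℕ} (hm : 2 ≤ m) {r : ℝ} (hr : 0 < r) :
    μH[(m : ℝ) - 1] (sphere (0 : EuclideanSpace ℝ (Fin m)) r) < ⊤ := by
  have hm' : (0 : ℝ) ≤ (m : ℝ) - 1 := by
    have : (2 : ℝ) ≤ m := by exact_mod_cast hm
    linarith
  refine (isCompact_sphere _ _).measure_lt_top_of_nhdsWithin fun p hp => ?_
  have hp : ‖p‖ = r := by simpa using hp
  have hp0 : p ≠ 0 := by rintro rfl; simp at hp; exact hr.ne hp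
  have := aux_haar hm hp0
  obtain ⟨K, t, ht, hL⟩ := (gr_contDiffAt p r).exists_lipschitzOnWith
  obtain ⟨ε, hε, hb⟩ := Metric.mem_nhds_iff.1 ht
  refine ⟨gr p r '' (ball 0 ε), ?_, ?_⟩
  · rw [mem_nhdsWithin_iff_exists_mem_nhds_inter]
    refine ⟨{y | 0 < inner ℝ p y} ∩ (ℝ ∙ p)ᗮ.orthogonalProjectionOnto ⁻¹' (ball 0 ε), ?_, ?_⟩
    · refine Filter.inter_mem ?_ ?_
      · refine (isOpen_lt continuous_const (by fun_prop)).mem_nhds ?_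
        simp only [Set.mem_ofPred_eq, real_inner_self_eq_norm_sq, hp]; positivity
      · refine ((isOpen_ball).preimage (ContinuousLinearMap.continuous _)).mem_nhds ?_
        have := gr_proj p r 0
        rw [gr_zero] at this
        rw [Set.mem_preimage, this]
        exact mem_ball_self hε
    · rintro y ⟨⟨h1, h2⟩, h3⟩
      exact ⟨_, h2, gr_inv hr hp (by simpa using h3) h1⟩
  · refine lt_of_le_of_lt ((hL.mono hb).hausdorffMeasure_image_le hm') ?_
    exact ENNReal.mul_lt_top (ENNReal.rpow_lt_top_of_nonneg hm' ENNReal.coe_ne_top) measure_ball_lt_top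

theorem sph_pos {m : ℕ} (hm : 2 ≤ m) {r : ℝ} (hr : 0 < r) {p : EuclideanSpace ℝ (Fin m)}
    (hp : ‖p‖ = r) {U : Set (EuclideanSpace ℝ (Fin m))} (hU : U ∈ nhds p) :
    0 < μH[(m : ℝ) - 1] (U ∩ sphere (0 : EuclideanSpace ℝ (Fin m)) r) := by
  have hm' : (0 : ℝ) ≤ (m : ℝ) - 1 := by
    have : (2 : ℝ) ≤ m := by exact_mod_cast hm
    linarith
  have hp0 : p ≠ 0 := by rintro rfl; simp at hp; exact hr.ne hp
  have := aux_haar hm hp0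
  have h1 : gr p r ⁻¹' U ∈ nhds 0 := (gr_contDiffAt p r).continuousAt.preimage_mem_nhds
    (by rwa [gr_zero])
  have h2 : gr p r ⁻¹' U ∩ ball 0 r ∈ nhds 0 := Filter.inter_mem h1 (ball_mem_nhds _ hr)
  have h3 := Measure.measure_pos_of_mem_nhds (μH[(m : ℝ) - 1] : Measure (ℝ ∙ p)ᗮ) h2
  have hL : LipschitzWith 1 (ℝ ∙ p)ᗮ.orthogonalProjectionOnto :=
    (ContinuousLinearMap.lipschitz _).weaken (by
      exact_mod_cast (ℝ ∙ p)ᗮ.orthogonalProjectionOnto_norm_le)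
  have h4 := hL.hausdorffMeasure_image_le hm' (U ∩ sphere (0 : EuclideanSpace ℝ (Fin m)) r)
  simp only [ENNReal.coe_one, ENNReal.one_rpow, one_mul] at h4
  refine lt_of_lt_of_le h3 (le_trans (measure_mono ?_) h4)
  rintro z ⟨hz1, hz2⟩
  refine ⟨gr p r z, ⟨hz1, ?_⟩, gr_proj p r z⟩
  simpa using gr_mem hr hp (by simpa using (mem_ball_zero_iff.1 hz2).le)
theorem param_deriv {E : Type*} [NormedAddCommGroup E] [MeasurableSpace E] [BorelSpace E]
    [SecondCountableTopology E] {μ : Measure E} {K : Set E} (hK : IsCompact K) (hμ : μ K < ⊤)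
    (F F' : ℝ → E → ℝ) (hF : Continuous fun q : ℝ × E => F q.1 q.2)
    (hF' : Continuous fun q : ℝ × E => F' q.1 q.2)
    (hd : ∀ t a, HasDerivAt (fun s => F s a) (F' t a) t) (t : ℝ) :
    HasDerivAt (fun s => ∫ a in K, F s a ∂μ) (∫ a in K, F' t a ∂μ) t := by
  have hfin : IsFiniteMeasure (μ.restrict K) := ⟨by simpa using hμ⟩
  have hc : ∀ s, Continuous (F s) := fun s => hF.comp (by fun_prop : Continuous fun a : E => (s, a))
  have hc' : ∀ s, Continuous (F' s) := fun s =>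
    hF'.comp (by fun_prop : Continuous fun a : E => (s, a))
  obtain ⟨C, hC⟩ := ((isCompact_closedBall t 1).prod hK).exists_bound_of_continuousOn hF'.continuousOn
  obtain ⟨C₀, hC₀⟩ := hK.exists_bound_of_continuousOn (hc t).continuousOn
  have hae : ∀ᵐ a ∂(μ.restrict K), a ∈ K := ae_restrict_mem hK.measurableSet
  refine (hasDerivAt_integral_of_dominated_loc_of_deriv_le (bound := fun _ => C)
    (closedBall_mem_nhds t one_pos)
    (Filter.Eventually.of_forall fun s => (hc s).aestronglyMeasurable) ?_
    (hc' t).aestronglyMeasurable ?_ (integrable_const C) ?_).2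
  · exact Integrable.of_bound (hc t).aestronglyMeasurable C₀ (hae.mono hC₀)
  · filter_upwards [hae] with a ha s hs
    exact hC (s, a) ⟨hs, ha⟩
  · exact Filter.Eventually.of_forall fun a s _ => hd s a

/-- rotation in the `(i,j)` plane -/
def rotL {m : ℕ} (i j : Fin m) (θ : ℝ) :
    EuclideanSpace ℝ (Fin m) →ₗ[ℝ] EuclideanSpace ℝ (Fin m) where
  toFun w := w + ((cos θ - 1) * w i - sin θ * w j) • EuclideanSpace.single i (1 : ℝ)
    + (sin θ * w i + (cos θ - 1) * w j) • EuclideanSpace.single j (1 : ℝ)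
  map_add' a b := by
    simp only [PiLp.add_apply]
    module
  map_smul' c a := by
    simp only [PiLp.smul_apply, smul_eq_mul, RingHom.id_apply]
    module

theorem rotL_norm {m : ℕ} {i j : Fin m} (hij : i ≠ j) (θ : ℝ) (w : EuclideanSpace ℝ (Fin m)) :
    ‖rotL i j θ w‖ = ‖w‖ := by
  have h : ‖rotL i j θ w‖ ^ 2 = ‖w‖ ^ 2 := by
    simp only [rotL, LinearMap.coe_mk, AddHom.coe_mk]
    rw [norm_add_sq_real, norm_add_sq_real]
    simp only [inner_add_left, inner_smul_left, inner_smul_right, norm_smul,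
      EuclideanSpace.inner_single_right, EuclideanSpace.norm_single]
    simp [hij, Ne.symm hij, PiLp.single_apply]
    linear_combination ((w i) ^ 2 + (w j) ^ 2) * (Real.sin_sq_add_cos_sq θ)
  exact (pow_left_inj₀ (norm_nonneg _) (norm_nonneg _) two_ne_zero).1 h

theorem rot_inv {m : ℕ} {i j : Fin m} (hij : i ≠ j) (θ r : ℝ) (g : EuclideanSpace ℝ (Fin m) → ℝ) :
    ∫ w in sphere 0 r, g (rotL i j θ w) ∂(μH[(m : ℝ) - 1])
      = ∫ w in sphere 0 r, g w ∂(μH[(m : ℝ) - 1]) := by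
  let R : EuclideanSpace ℝ (Fin m) →ₗᵢ[ℝ] EuclideanSpace ℝ (Fin m) := ⟨rotL i j θ, rotL_norm hij θ⟩
  let e := (R.toLinearIsometryEquiv rfl).toIsometryEquiv
  have h := (e.measurePreserving_hausdorffMeasure ((m : ℝ) - 1)).setIntegral_preimage_emb
    e.toHomeomorph.measurableEmbedding g (sphere 0 r)
  have hpre : e ⁻¹' (sphere 0 r) = sphere 0 r := by
    ext w
    have : e w = rotL i j θ w := rfl
    rw [Set.mem_preimage, mem_sphere_zero_iff_norm, mem_sphere_zero_iff_norm, this, rotL_norm hij]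
  rw [hpre] at h
  exact h

theorem rot_int {m : ℕ} (hm : 2 ≤ m) {i j : Fin m} {r : ℝ} (hr : 0 < r)
    (g : EuclideanSpace ℝ (Fin m) → ℝ)
    (g' : EuclideanSpace ℝ (Fin m) → (EuclideanSpace ℝ (Fin m) →L[ℝ] ℝ))
    (hg : ∀ y, HasFDerivAt g (g' y) y) (hg' : Continuous g') :
    ∫ w in sphere 0 r, g' w (w i • EuclideanSpace.single j (1 : ℝ)
      - w j • EuclideanSpace.single i (1 : ℝ)) ∂(μH[(m : ℝ) - 1]) = 0 := by
  by_cases hij : i = j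
  · subst hij; simp
  have hgc : Continuous g := continuous_iff_continuousAt.2 fun y => (hg y).continuousAt
  have hrc : Continuous fun q : ℝ × EuclideanSpace ℝ (Fin m) => rotL i j q.1 q.2 := by
    simp only [rotL, LinearMap.coe_mk, AddHom.coe_mk]
    fun_prop
  have key := param_deriv (μ := μH[(m : ℝ) - 1]) (isCompact_sphere (0 : EuclideanSpace ℝ (Fin m)) r)
    (sph_finite hm hr) (fun θ w => g (rotL i j θ w))
    (fun θ w => g' (rotL i j θ w) ((-sin θ * w i - cos θ * w j) • EuclideanSpace.single i (1 : ℝ)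
      + (cos θ * w i + (-sin θ) * w j) • EuclideanSpace.single j (1 : ℝ)))
    (hgc.comp hrc) ((hg'.comp hrc).clm_apply (by fun_prop)) (by
      intro t w
      refine (hg (rotL i j t w)).comp_hasDerivAt t ?_
      simp only [rotL, LinearMap.coe_mk, AddHom.coe_mk]
      have h1 : HasDerivAt (fun θ => (cos θ - 1) * w i - sin θ * w j)
          (-sin t * w i - cos t * w j) t :=
        (((Real.hasDerivAt_cos t).sub_const 1).mul_const _).sub
          ((Real.hasDerivAt_sin t).mul_const _)
      have h2 : HasDerivAt (fun θ => sin θ * w i + (cos θ - 1) * w j)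
          (cos t * w i + (-sin t) * w j) t :=
        ((Real.hasDerivAt_sin t).mul_const _).add
          (((Real.hasDerivAt_cos t).sub_const 1).mul_const _)
      exact ((h1.smul_const _).const_add w).add (h2.smul_const _)) 0
  have hconst : (fun θ => ∫ w in sphere 0 r, g (rotL i j θ w) ∂(μH[(m : ℝ) - 1]))
      = fun _ => ∫ w in sphere 0 r, g w ∂(μH[(m : ℝ) - 1]) := by
    funext θ; exact rot_inv hij θ r g
  rw [hconst] at key
  have := key.unique (hasDerivAt_const _ _)
  rw [← this]
  congr 1
  funext w
  have h0 : rotL i j 0 w = w := by simp [rotL]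
  rw [h0]
  congr 1
  simp
  module

theorem int_cont {m : ℕ} (hm : 2 ≤ m) {x : EuclideanSpace ℝ (Fin m)} {r : ℝ}
    (hfin : μH[(m : ℝ) - 1] (sphere x r) < ⊤)
    {f : EuclideanSpace ℝ (Fin m) → ℝ} (hf : ContinuousOn f (sphere x r)) :
    IntegrableOn f (sphere x r) (μH[(m : ℝ) - 1]) := by
  have hf' : IsFiniteMeasure ((μH[(m : ℝ) - 1] : Measure (EuclideanSpace ℝ (Fin m))).restrict
    (sphere x r)) := ⟨by simpa using hfin⟩
  obtain ⟨C, hC⟩ := (isCompact_sphere x r).exists_bound_of_continuousOn hf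
  exact Integrable.of_bound (hf.aestronglyMeasurable (isCompact_sphere x r).measurableSet) C
    ((ae_restrict_mem (isCompact_sphere x r).measurableSet).mono hC)

theorem ode_const {m : ℕ} (hm : 2 ≤ m) (φ φ' φ'' : ℝ → ℝ) (hφ : ∀ t, HasDerivAt φ (φ' t) t)
    (hφ' : ∀ t, HasDerivAt φ' (φ'' t) t)
    (hode : ∀ t ∈ Set.Icc (0 : ℝ) 1, t * φ'' t + ((m : ℝ) - 1) * φ' t = 0) : φ 1 = φ 0 := by
  obtain ⟨k, rfl⟩ : ∃ k, m = k + 2 := ⟨m - 2, by omega⟩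
  have hψ : ∀ t ∈ Set.Icc (0 : ℝ) 1, t ^ (k + 1) * φ' t = 0 := by
    have hd : ∀ t, HasDerivAt (fun t => t ^ (k + 1) * φ' t)
        (((k + 1 : ℕ) : ℝ) * t ^ k * φ' t + t ^ (k + 1) * φ'' t) t := fun t =>
      (hasDerivAt_pow (k + 1) t).mul (hφ' t)
    intro t ht
    have := constant_of_has_deriv_right_zero (f := fun t => t ^ (k + 1) * φ' t) (a := 0) (b := 1)
      (fun t _ => (hd t).continuousAt.continuousWithinAt) (fun s hs => by
        have h0 := hode s ⟨hs.1, hs.2.le⟩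
        have h1 : ((k + 1 : ℕ) : ℝ) * s ^ k * φ' s + s ^ (k + 1) * φ'' s = 0 := by
          push_cast at h0 ⊢
          linear_combination s ^ k * h0
        have h2 := hd s
        rw [h1] at h2
        exact h2.hasDerivWithinAt) t ht
    simpa using this
  have hφ'0 : ∀ t ∈ Set.Ioo (0 : ℝ) 1, φ' t = 0 := fun t ht =>
    (mul_eq_zero.1 (hψ t ⟨ht.1.le, ht.2.le⟩)).resolve_left (pow_ne_zero _ ht.1.ne')
  obtain ⟨c, hc, hce⟩ := exists_hasDerivAt_eq_slope φ φ' zero_lt_one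
    (fun t _ => (hφ t).continuousAt.continuousWithinAt) (fun t _ => hφ t)
  rw [hφ'0 c hc] at hce
  simp at hce; linarith

theorem mvp_aux {m : ℕ} (hm : 2 ≤ m) {V : EuclideanSpace ℝ (Fin m) → ℝ} (hV : ContDiff ℝ 2 V)
    (x : EuclideanSpace ℝ (Fin m)) {r : ℝ} (hr : 0 < r)
    (hl : ∀ y ∈ closedBall x r, lap V y = 0) :
    ∫ w in sphere 0 r, V (x + w) ∂(μH[(m : ℝ) - 1])
      = ∫ _ in sphere (0 : EuclideanSpace ℝ (Fin m)) r, V x ∂(μH[(m : ℝ) - 1]) := by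
  have hfin := sph_finite hm hr
  have hsp := isCompact_sphere (0 : EuclideanSpace ℝ (Fin m)) r
  let e : Fin m → EuclideanSpace ℝ (Fin m) := fun j => EuclideanSpace.single j (1 : ℝ)
  have hsum : ∀ w : EuclideanSpace ℝ (Fin m), ∑ j, w j • e j = w := by
    intro w
    ext k
    simp [e, Finset.sum_apply, Pi.single_apply]
  have hlin : ∀ (L : EuclideanSpace ℝ (Fin m) →L[ℝ] ℝ) (w : EuclideanSpace ℝ (Fin m)),
      L w = ∑ j, w j * L (e j) := by
    intro L w
    have h := congrArg L (hsum w)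
    rw [map_sum] at h
    simpa using h.symm
  let g : Fin m → EuclideanSpace ℝ (Fin m) → ℝ := fun j y => fderiv ℝ V y (e j)
  have hg1 : ∀ j, ContDiff ℝ 1 (g j) := fun j =>
    (hV.fderiv_right (m := 1) (by norm_num)).clm_apply contDiff_const
  have hgc : ∀ j, Continuous (g j) := fun j => (hg1 j).continuous
  have hgd : ∀ j y, HasFDerivAt (g j) (fderiv ℝ (g j) y) y := fun j y =>
    ((hg1 j).differentiable one_ne_zero y).hasFDerivAt
  have hgdc : ∀ j, Continuous (fderiv ℝ (g j)) := fun j => (hg1 j).continuous_fderiv one_ne_zero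
  have hline : ∀ (w : EuclideanSpace ℝ (Fin m)) (t : ℝ), HasDerivAt (fun s : ℝ => x + s • w) w t := by
    intro w t
    simpa using ((hasDerivAt_id t).smul_const w).const_add x
  -- first derivative
  have hφ : ∀ t : ℝ, HasDerivAt (fun s => ∫ w in sphere 0 r, V (x + s • w) ∂(μH[(m : ℝ) - 1]))
      (∫ w in sphere 0 r, ∑ j, w j * g j (x + t • w) ∂(μH[(m : ℝ) - 1])) t := by
    refine param_deriv hsp hfin (fun s w => V (x + s • w)) (fun t w => ∑ j, w j * g j (x + t • w))
      (hV.continuous.comp (by fun_prop)) ?_ ?_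
    · exact continuous_finsetSum _ fun j _ => Continuous.mul (by fun_prop)
        ((hgc j).comp (by fun_prop))
    · intro t w
      have h1 := ((hV.differentiable two_ne_zero (x + t • w)).hasFDerivAt).comp_hasDerivAt t
        (hline w t)
      rw [hlin] at h1
      exact h1
  have hφ' : ∀ t : ℝ, HasDerivAt
      (fun s => ∫ w in sphere 0 r, ∑ j, w j * g j (x + s • w) ∂(μH[(m : ℝ) - 1]))
      (∫ w in sphere 0 r, ∑ j, w j * fderiv ℝ (g j) (x + t • w) w ∂(μH[(m : ℝ) - 1])) t := by
    refine param_deriv hsp hfin (fun s w => ∑ j, w j * g j (x + s • w))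
      (fun t w => ∑ j, w j * fderiv ℝ (g j) (x + t • w) w) ?_ ?_ ?_
    · exact continuous_finsetSum _ fun j _ => Continuous.mul (by fun_prop)
        ((hgc j).comp (by fun_prop))
    · exact continuous_finsetSum _ fun j _ => Continuous.mul (by fun_prop)
        (((hgdc j).comp (by fun_prop)).clm_apply (by fun_prop))
    · intro t w
      exact HasDerivAt.fun_sum fun j _ =>
        ((hgd j (x + t • w)).comp_hasDerivAt t (hline w t)).const_mul _
  set φ : ℝ → ℝ := fun s => ∫ w in sphere 0 r, V (x + s • w) ∂(μH[(m : ℝ) - 1]) with hφdef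
  set φ' : ℝ → ℝ := fun s => ∫ w in sphere 0 r, ∑ j, w j * g j (x + s • w) ∂(μH[(m : ℝ) - 1])
    with hφ'def
  set φ'' : ℝ → ℝ := fun t =>
    ∫ w in sphere 0 r, ∑ j, w j * fderiv ℝ (g j) (x + t • w) w ∂(μH[(m : ℝ) - 1]) with hφ''def
  have hode : ∀ t ∈ Set.Icc (0 : ℝ) 1, t * φ'' t + ((m : ℝ) - 1) * φ' t = 0 := by
    intro t ht
    -- integrated rotation identities
    let pr : Fin m → (EuclideanSpace ℝ (Fin m) →L[ℝ] ℝ) := fun i => EuclideanSpace.proj i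
    let G' : Fin m → Fin m → EuclideanSpace ℝ (Fin m) → (EuclideanSpace ℝ (Fin m) →L[ℝ] ℝ) :=
      fun i j w => (w i) • (t • fderiv ℝ (g j) (x + t • w)) + g j (x + t • w) • pr i
    have hG : ∀ i j w, HasFDerivAt (fun w : EuclideanSpace ℝ (Fin m) => w i * g j (x + t • w))
        (G' i j w) w := by
      intro i j w
      have h1 : HasFDerivAt (fun w : EuclideanSpace ℝ (Fin m) => w i) (pr i) w :=
        (pr i).hasFDerivAt
      have h2 : HasFDerivAt (fun w : EuclideanSpace ℝ (Fin m) => x + t • w)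
          (t • ContinuousLinearMap.id ℝ (EuclideanSpace ℝ (Fin m))) w :=
        ((hasFDerivAt_id w).const_smul t).const_add x
      have h3 : HasFDerivAt (fun w : EuclideanSpace ℝ (Fin m) => g j (x + t • w))
          (t • fderiv ℝ (g j) (x + t • w)) w := by
        have := (hgd j (x + t • w)).comp w h2
        have he : (fderiv ℝ (g j) (x + t • w)).comp
            (t • ContinuousLinearMap.id ℝ (EuclideanSpace ℝ (Fin m)))
            = t • fderiv ℝ (g j) (x + t • w) := by
          ext v; simp
        rw [he] at this
        exact this
      exact h1.mul h3
    have hGc : ∀ i j, Continuous (G' i j) := by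
      intro i j
      have hl1 : Continuous fun w : EuclideanSpace ℝ (Fin m) => x + t • w := by fun_prop
      have hl2 : Continuous fun w : EuclideanSpace ℝ (Fin m) => w i := by fun_prop
      exact (hl2.smul (((hgdc j).comp hl1).const_smul t)).add
        (((hgc j).comp hl1).smul continuous_const)
    have hI : ∑ i, ∑ j, ∫ w in sphere 0 r, G' i j w (w i • e j - w j • e i) ∂(μH[(m : ℝ) - 1]) = 0 :=
      Finset.sum_eq_zero fun i _ => Finset.sum_eq_zero fun j _ =>
        rot_int hm hr _ (G' i j) (hG i j) (hGc i j)
    have hzero : ∀ i j, IntegrableOn (fun w => G' i j w (w i • e j - w j • e i)) (sphere 0 r)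
        (μH[(m : ℝ) - 1]) := fun i j =>
      int_cont hm hfin ((hGc i j).clm_apply (by fun_prop)).continuousOn
    rw [Finset.sum_congr rfl fun i _ => (integral_finsetSum _ fun j _ => hzero i j).symm,
      ← integral_finsetSum _ fun i _ => integrable_finsetSum _ fun j _ => hzero i j] at hI
    have hpt : ∀ w ∈ sphere (0 : EuclideanSpace ℝ (Fin m)) r,
        ∑ i, ∑ j, G' i j w (w i • e j - w j • e i)
          = -(t * ∑ j, w j * fderiv ℝ (g j) (x + t • w) w
            + ((m : ℝ) - 1) * ∑ j, w j * g j (x + t • w)) := by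
      intro w hw
      have hw' : ‖w‖ = r := by simpa using hw
      have hlap : ∑ j, fderiv ℝ (g j) (x + t • w) (e j) = 0 := by
        refine hl (x + t • w) ?_
        rw [mem_closedBall, dist_eq_norm, add_sub_cancel_left, norm_smul, hw', Real.norm_eq_abs,
          abs_of_nonneg ht.1]
        nlinarith [ht.2]
      have hDw : ∀ j, fderiv ℝ (g j) (x + t • w) w
          = ∑ i, w i * fderiv ℝ (g j) (x + t • w) (e i) := by
        intro j
        exact hlin _ w
      have hterm : ∀ i j, G' i j w (w i • e j - w j • e i)
          = t * ((w i) ^ 2 * fderiv ℝ (g j) (x + t • w) (e j))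
            - t * (w j * (w i * fderiv ℝ (g j) (x + t • w) (e i)))
            + ((if i = j then w i * g j (x + t • w) else 0) - w j * g j (x + t • w)) := by
        intro i j
        have h1 : pr i (e j) = if i = j then 1 else 0 := by
          simp [pr, e, PiLp.single_apply]
        have h2 : pr i (e i) = 1 := by simp [pr, e]
        simp only [G', ContinuousLinearMap.add_apply, ContinuousLinearMap.smul_apply, map_sub,
          map_smul, smul_eq_mul, h1, h2]
        split_ifs <;> ring
      simp_rw [hterm, hDw]
      simp only [Finset.sum_add_distrib, Finset.sum_sub_distrib, ← Finset.mul_sum, hlap,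
        Finset.sum_ite_eq, Finset.mem_univ, if_true, mul_zero, Finset.sum_const_zero,
        Finset.sum_const, Finset.card_univ, Fintype.card_fin, nsmul_eq_mul]
      rw [Finset.sum_comm]
      simp only [← Finset.mul_sum]
      ring
    rw [setIntegral_congr_fun hsp.measurableSet hpt, integral_neg, neg_eq_zero,
      integral_add, integral_const_mul, integral_const_mul] at hI
    · exact hI
    · refine (int_cont hm hfin (Continuous.continuousOn ?_)).const_mul t
      exact continuous_finsetSum _ fun j _ => Continuous.mul (by fun_prop)
        (((hgdc j).comp (by fun_prop)).clm_apply (by fun_prop))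
    · refine (int_cont hm hfin (Continuous.continuousOn ?_)).const_mul _
      exact continuous_finsetSum _ fun j _ => Continuous.mul (by fun_prop)
        ((hgc j).comp (by fun_prop))
  have h := ode_const hm φ φ' φ'' hφ hφ' hode
  simp only [hφdef, one_smul, zero_smul, add_zero] at h
  exact h
theorem pre_sph {m : ℕ} (x : EuclideanSpace ℝ (Fin m)) (r : ℝ) :
    (IsometryEquiv.addLeft x) ⁻¹' (sphere x r) = sphere 0 r := by
  ext w
  rw [Set.mem_preimage, mem_sphere_zero_iff_norm, mem_sphere_iff_norm]
  simp

theorem sph_meas {m : ℕ} (x : EuclideanSpace ℝ (Fin m)) (r : ℝ) :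
    μH[(m : ℝ) - 1] (sphere x r) = μH[(m : ℝ) - 1] (sphere (0 : EuclideanSpace ℝ (Fin m)) r) := by
  rw [← pre_sph x r, IsometryEquiv.hausdorffMeasure_preimage]

theorem sph_pos' {m : ℕ} (hm : 2 ≤ m) {r : ℝ} (hr : 0 < r) {x p : EuclideanSpace ℝ (Fin m)}
    (hp : p ∈ sphere x r) {U : Set (EuclideanSpace ℝ (Fin m))} (hU : U ∈ nhds p) :
    0 < μH[(m : ℝ) - 1] (U ∩ sphere x r) := by
  rw [← IsometryEquiv.hausdorffMeasure_preimage (IsometryEquiv.addLeft x), Set.preimage_inter,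
    pre_sph]
  refine sph_pos hm hr (p := p - x) (by rwa [mem_sphere_iff_norm] at hp) ?_
  refine (IsometryEquiv.addLeft x).continuous.continuousAt.preimage_mem_nhds ?_
  simpa using hU

theorem sph_int {m : ℕ} (x : EuclideanSpace ℝ (Fin m)) (r : ℝ) (f : EuclideanSpace ℝ (Fin m) → ℝ) :
    ∫ y in sphere x r, f y ∂(μH[(m : ℝ) - 1])
      = ∫ w in sphere 0 r, f (x + w) ∂(μH[(m : ℝ) - 1]) := by
  have h := ((IsometryEquiv.addLeft x).measurePreserving_hausdorffMeasure
    ((m : ℝ) - 1)).setIntegral_preimage_emb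
    (IsometryEquiv.addLeft x).toHomeomorph.measurableEmbedding f (sphere x r)
  rw [pre_sph] at h
  exact h.symm

theorem lap_congr {m : ℕ} {u v : EuclideanSpace ℝ (Fin m) → ℝ} {x : EuclideanSpace ℝ (Fin m)}
    (h : u =ᶠ[nhds x] v) : lap u x = lap v x := by
  unfold lap
  refine Finset.sum_congr rfl fun i _ => ?_
  have h1 : (fun y => fderiv ℝ u y (EuclideanSpace.single i 1))
      =ᶠ[nhds x] fun y => fderiv ℝ v y (EuclideanSpace.single i 1) :=
    (h.fderiv (𝕜 := ℝ)).mono fun y hy => by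
      have hy : fderiv ℝ u y = fderiv ℝ v y := hy
      simp only [hy]
  rw [h1.fderiv_eq]

theorem mvp {m : ℕ} (hm : 2 ≤ m) {D : Set (EuclideanSpace ℝ (Fin m))} (hD : IsOpen D)
    {v : EuclideanSpace ℝ (Fin m) → ℝ} (hv : IsHarmonicOn v D) {x : EuclideanSpace ℝ (Fin m)} {r : ℝ}
    (hr : 0 < r) (hb : closedBall x r ⊆ D) :
    ∫ y in sphere x r, v y ∂(μH[(m : ℝ) - 1])
      = ∫ _ in sphere x r, v x ∂(μH[(m : ℝ) - 1]) := by
  obtain ⟨δ, hδ, hsub⟩ := (isCompact_closedBall x r).exists_cthickening_subset_open hD hb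
  rw [cthickening_closedBall hδ.le hr.le] at hsub
  let χ : ContDiffBump x := ⟨r + δ / 2, δ + r, by positivity, by linarith⟩
  have hχ1 : ∀ y ∈ ball x (r + δ / 2), χ y = 1 := fun y hy =>
    χ.one_of_mem_closedBall (ball_subset_closedBall hy)
  have hV : ContDiff ℝ 2 (fun y => χ y * v y) := by
    rw [contDiff_iff_contDiffAt]
    intro y
    by_cases hy : y ∈ D
    · exact χ.contDiff.contDiffAt.mul (hv.1.contDiffAt (hD.mem_nhds hy))
    · have hy' : y ∉ closedBall x (δ + r) := fun h => hy (hsub h)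
      refine (contDiffAt_const (c := (0 : ℝ))).congr_of_eventuallyEq ?_
      filter_upwards [isClosed_closedBall.isOpen_compl.mem_nhds hy'] with z hz
      have : χ z = 0 := χ.zero_of_le_dist (by
        have := hz
        rw [Set.mem_compl_iff, mem_closedBall, not_le] at this
        exact this.le)
      simp [this]
  have heq : ∀ y ∈ closedBall x r, (fun y => χ y * v y) =ᶠ[nhds y] v := by
    intro y hy
    have : y ∈ ball x (r + δ / 2) := by
      rw [mem_closedBall] at hy
      rw [mem_ball]; linarith
    filter_upwards [isOpen_ball.mem_nhds this] with z hz
    rw [hχ1 z hz, one_mul]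
  have key := mvp_aux hm hV x hr fun y hy => by
    rw [lap_congr (heq y hy)]; exact hv.2 y (hb hy)
  rw [← sph_int x r (fun y => χ y * v y), ← sph_int x r (fun _ => (χ x * v x))] at key
  have hx : χ x * v x = v x := (heq x (mem_closedBall_self hr.le)).eq_of_nhds
  rw [hx] at key
  rw [← key]
  refine setIntegral_congr_fun isClosed_sphere.measurableSet fun y hy => ?_
  exact (heq y (sphere_subset_closedBall hy)).eq_of_nhds.symm

theorem max_aux {m : ℕ} (hm : 2 ≤ m) {D : Set (EuclideanSpace ℝ (Fin m))} (hD : IsOpen D)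
    (hDb : Bornology.IsBounded D) {w : EuclideanSpace ℝ (Fin m) → ℝ}
    (hw : ContinuousOn w (closure D)) (h0 : ∀ x ∈ frontier D, w x = 0)
    (hmv : ∀ x ∈ D, ∃ r : ℝ, 0 < r ∧ closedBall x r ⊆ D ∧
      ∫ y in sphere x r, (w x - w y) ∂(μH[(m : ℝ) - 1]) = 0) :
    ∀ x ∈ D, w x ≤ 0 := by
  by_contra! hcon
  obtain ⟨x₀, hx₀, hpos⟩ := hcon
  have hcpt : IsCompact (closure D) := hDb.isCompact_closure
  obtain ⟨a, ha, hmax⟩ := hcpt.exists_isMaxOn ⟨x₀, subset_closure hx₀⟩ hw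
  have hMpos : 0 < w a := lt_of_lt_of_le hpos (hmax (subset_closure hx₀))
  have hKc : IsCompact (closure D ∩ w ⁻¹' {w a}) :=
    hcpt.of_isClosed_subset (hw.preimage_isClosed_of_isClosed isClosed_closure isClosed_singleton)
      Set.inter_subset_left
  let i : Fin m := ⟨0, by omega⟩
  obtain ⟨b, ⟨hb, hba⟩, hbmax⟩ := hKc.exists_isMaxOn ⟨a, ha, rfl⟩
    (f := fun y : EuclideanSpace ℝ (Fin m) => y i) (by fun_prop)
  have hba : w b = w a := hba
  have hbD : b ∈ D := by
    by_contra hbD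
    have : b ∈ frontier D := by rw [hD.frontier_eq]; exact ⟨hb, hbD⟩
    rw [h0 b this] at hba
    linarith
  obtain ⟨r, hr, hsub, hzero⟩ := hmv b hbD
  have hsD : sphere b r ⊆ D := sphere_subset_closedBall.trans hsub
  let q : EuclideanSpace ℝ (Fin m) := b + r • EuclideanSpace.single i (1 : ℝ)
  have hq : q ∈ sphere b r := by
    simp [q, norm_smul, abs_of_pos hr]
  have hfin : μH[(m : ℝ) - 1] (sphere b r) < ⊤ := by rw [sph_meas]; exact sph_finite hm hr
  have hwq : w q = w a := by
    by_contra hne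
    have hlt : w q < w b := by
      rw [hba]; exact lt_of_le_of_ne (hmax (subset_closure (hsD hq))) hne
    have hU : {y | w y < w b} ∈ nhds q :=
      (hw.continuousAt (Filter.mem_of_superset (hD.mem_nhds (hsD hq)) subset_closure)).eventually_lt
        continuousAt_const hlt
    have hp := sph_pos' hm hr hq hU
    rw [setIntegral_eq_zero_iff_of_nonneg_ae ?_ ?_] at hzero
    · have hz : ∀ᵐ y ∂((μH[(m : ℝ) - 1]).restrict (sphere b r)), ¬ (w y < w b) := by
        filter_upwards [hzero] with y hy
        have hy : w b - w y = 0 := hy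
        linarith
      rw [ae_iff] at hz
      simp only [not_not] at hz
      rw [Measure.restrict_apply' isClosed_sphere.measurableSet] at hz
      exact hp.ne' hz
    · filter_upwards [ae_restrict_mem isClosed_sphere.measurableSet] with y hy
      have : w y ≤ w a := hmax (subset_closure (hsD hy))
      simp only [Pi.zero_apply]
      linarith
    · exact int_cont hm hfin (continuousOn_const.sub (hw.mono (hsD.trans subset_closure)))
  have h1 : q i ≤ b i := hbmax ⟨subset_closure (hsD hq), hwq⟩
  simp [q] at h1
  linarith

theorem mv_of_avg {m : ℕ} (hm : 2 ≤ m) {u : EuclideanSpace ℝ (Fin m) → ℝ}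
    {x : EuclideanSpace ℝ (Fin m)} {r : ℝ} (hr : 0 < r) (h : u x = sphAvg u x r) :
    ∫ y in sphere x r, u y ∂(μH[(m : ℝ) - 1])
      = ∫ _ in sphere x r, u x ∂(μH[(m : ℝ) - 1]) := by
  have hfin : μH[(m : ℝ) - 1] (sphere x r) < ⊤ := by rw [sph_meas]; exact sph_finite hm hr
  have hne : (sphere x r).Nonempty := by
    refine ⟨x + r • EuclideanSpace.single ⟨0, by omega⟩ (1 : ℝ), ?_⟩
    simp [norm_smul, abs_of_pos hr]
  obtain ⟨p, hp⟩ := hne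
  have hpos : 0 < μH[(m : ℝ) - 1] (sphere x r) := by
    simpa using sph_pos' hm hr hp Filter.univ_mem
  have hpos' : (μH[(m : ℝ) - 1] (sphere x r)).toReal ≠ 0 :=
    (ENNReal.toReal_pos hpos.ne' hfin.ne).ne'
  rw [setIntegral_const, h, sphAvg, smul_eq_mul, Measure.real, mul_inv_cancel_left₀ hpos']

theorem restricted_mvp_with_dirichlet {m : ℕ} (hm : 2 ≤ m)
    (D : Set (EuclideanSpace ℝ (Fin m))) (hD : IsOpen D) (hDc : IsConnected D)
    (hDb : Bornology.IsBounded D)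
    (hdir : ∀ f : EuclideanSpace ℝ (Fin m) → ℝ, ContinuousOn f (frontier D) →
      ∃ v : EuclideanSpace ℝ (Fin m) → ℝ, ContinuousOn v (closure D) ∧
        IsHarmonicOn v D ∧ ∀ x ∈ frontier D, v x = f x)
    (u : EuclideanSpace ℝ (Fin m) → ℝ) (hcont : ContinuousOn u (closure D))
    (hmv : ∀ x ∈ D, ∃ r : ℝ, 0 < r ∧ closedBall x r ⊆ D ∧ u x = sphAvg u x r) :
    IsHarmonicOn u D := by 
  obtain ⟨v, hvc, hvh, hvf⟩ := hdir u (hcont.mono frontier_subset_closure)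
  have hcomm : ∀ x ∈ D, ∃ r : ℝ, 0 < r ∧ closedBall x r ⊆ D ∧
      ∫ y in sphere x r, ((u x - v x) - (u y - v y)) ∂(μH[(m : ℝ) - 1]) = 0 := by
    intro x hx
    obtain ⟨r, hr, hsub, h⟩ := hmv x hx
    refine ⟨r, hr, hsub, ?_⟩
    have hfin : μH[(m : ℝ) - 1] (sphere x r) < ⊤ := by rw [sph_meas]; exact sph_finite hm hr
    have hs : sphere x r ⊆ closure D :=
      (sphere_subset_closedBall.trans hsub).trans subset_closure
    have iu := int_cont hm hfin (hcont.mono hs)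
    have iv := int_cont hm hfin (hvc.mono hs)
    have ic : ∀ c : ℝ, IntegrableOn (fun _ => c) (sphere x r) (μH[(m : ℝ) - 1]) := fun c =>
      int_cont hm hfin continuousOn_const
    have h1 := mv_of_avg hm hr h
    have h2 := mvp hm hD hvh hr hsub
    have iuv : IntegrableOn (fun y => u y - v y) (sphere x r) (μH[(m : ℝ) - 1]) := iu.sub iv
    rw [integral_sub (ic (u x - v x)) iuv, integral_sub (ic (u x)) (ic (v x)),
      integral_sub iu iv, h1, h2, sub_self]
  have hle := max_aux hm hD hDb (hcont.sub hvc) (fun x hx => by simp [hvf x hx]) hcomm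
  have hge := max_aux hm hD hDb (hvc.sub hcont) (fun x hx => by simp [hvf x hx]) (fun x hx => by
    obtain ⟨r, hr, hsub, h⟩ := hcomm x hx
    refine ⟨r, hr, hsub, ?_⟩
    rw [← neg_eq_zero, ← integral_neg, ← h]
    congr 1
    funext y
    simp only [Pi.sub_apply]
    ring)
  have heq : ∀ x ∈ D, u x = v x := fun x hx => by
    have h1 := hle x hx
    have h2 := hge x hx
    simp only [Pi.sub_apply] at h1 h2
    linarith
  refine ⟨hvh.1.congr heq, fun x hx => ?_⟩
  rw [lap_congr (Filter.eventuallyEq_of_mem (hD.mem_nhds hx) heq)]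
  exact hvh.2 x hx
end
end

section
/- Liouville theorem for biharmonic functions: every bounded biharmonic function on ℝ^m is constant. -/
open MeasureTheory Metric Real

noncomputable section

local notation "𝔼" m => EuclideanSpace ℝ (Fin m)

/-- The truncated power of `1 - ‖z‖²`. -/
def psi {m : ℕ} (k : ℕ) (z : EuclideanSpace ℝ (Fin m)) : ℝ := max (1 - ‖z‖ ^ 2) 0 ^ k

lemma hasDerivAt_max_pow (n : ℕ) (t : ℝ) :
    HasDerivAt (fun t : ℝ => max t 0 ^ (n + 2)) ((n + 2) * max t 0 ^ (n + 1)) t := by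
  rcases lt_trichotomy t 0 with h | h | h
  · have h1 : (fun t : ℝ => max t 0 ^ (n + 2)) =ᶠ[nhds t] fun _ => 0 := by
      filter_upwards [Iio_mem_nhds h] with s hs
      have hs' : s < 0 := hs
      simp [max_eq_right hs'.le]
    rw [max_eq_right h.le]
    simpa using (hasDerivAt_const t (0 : ℝ)).congr_of_eventuallyEq h1
  · subst h
    have h0 : HasDerivAt (fun t : ℝ => t ^ 2) 0 0 := by simpa using hasDerivAt_pow 2 (0 : ℝ)
    rw [hasDerivAt_iff_isLittleO] at h0 ⊢
    simp only [sub_zero, smul_zero, max_self, ne_eq, Nat.add_eq_zero_iff, OfNat.ofNat_ne_zero,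
      and_false, not_false_eq_true, zero_pow, one_ne_zero, mul_zero] at h0 ⊢
    refine Asymptotics.IsBigO.trans_isLittleO ?_ h0
    refine Asymptotics.IsBigO.of_bound 1 ?_
    filter_upwards [Iio_mem_nhds (show (0 : ℝ) < 1 by norm_num)] with s hs
    have ha : 0 ≤ max s 0 := le_max_right _ _
    have hb : max s 0 ≤ 1 := max_le (le_of_lt hs) zero_le_one
    have hc : max s 0 ≤ |s| := max_le (le_abs_self s) (abs_nonneg s)
    rw [norm_of_nonneg (by positivity), norm_of_nonneg (by positivity), one_mul, ← sq_abs s]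
    calc max s 0 ^ (n + 2) ≤ max s 0 ^ 2 := pow_le_pow_of_le_one ha hb (by omega)
      _ ≤ |s| ^ 2 := by gcongr
  · have h1 : (fun t : ℝ => max t 0 ^ (n + 2)) =ᶠ[nhds t] fun t => t ^ (n + 2) := by
      filter_upwards [Ioi_mem_nhds h] with s hs
      rw [max_eq_left (le_of_lt hs)]
    rw [max_eq_left h.le]
    simpa using (hasDerivAt_pow (n + 2) t).congr_of_eventuallyEq h1

lemma psi_continuous {m : ℕ} (k : ℕ) : Continuous (psi (m := m) k) := by
  unfold psi; fun_prop

lemma psi_nonneg {m : ℕ} (k : ℕ) (z : 𝔼 m) : 0 ≤ psi k z := by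
  unfold psi; positivity

lemma psi_zero_of {m : ℕ} (k : ℕ) (z : 𝔼 m) (hz : 1 ≤ ‖z‖) : psi (k + 1) z = 0 := by
  unfold psi
  rw [max_eq_right (by nlinarith)]; simp

lemma psi_compact {m : ℕ} (k : ℕ) : HasCompactSupport (psi (m := m) (k + 1)) := by
  refine HasCompactSupport.intro (isCompact_closedBall 0 1) fun z hz => psi_zero_of k z ?_
  simp only [mem_closedBall, dist_zero_right, not_le] at hz
  exact hz.le

lemma psi_hasFDerivAt {m : ℕ} (k : ℕ) (z : 𝔼 m) :
    HasFDerivAt (psi (m := m) (k + 2))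
      ((((k : ℝ) + 2) * psi (k + 1) z) • (-((2 : ℕ) • innerSL ℝ z))) z := by
  have h1 : HasFDerivAt (fun z : 𝔼 m => 1 - ‖z‖ ^ 2) (-((2 : ℕ) • innerSL ℝ z)) z := by
    have := ((hasStrictFDerivAt_norm_sq z).hasFDerivAt).const_sub 1
    simpa using this
  exact (hasDerivAt_max_pow k (1 - ‖z‖ ^ 2)).comp_hasFDerivAt z h1

lemma psi_fderiv {m : ℕ} (k : ℕ) (z : 𝔼 m) (i : Fin m) :
    fderiv ℝ (psi (m := m) (k + 2)) z (EuclideanSpace.single i 1)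
      = -(2 * (k + 2)) * (z i * psi (k + 1) z) := by
  rw [(psi_hasFDerivAt k z).fderiv]
  simp [EuclideanSpace.inner_single_right]
  ring

lemma psi_integral_pos {m : ℕ} (k : ℕ) : 0 < ∫ z : 𝔼 m, psi (k + 1) z := by
  refine (psi_continuous (k + 1)).integral_pos_of_hasCompactSupport_nonneg_nonzero
    (psi_compact k) (psi_nonneg _) (x := 0) ?_
  simp [psi]

lemma integrable_mul_psi {m : ℕ} (k : ℕ) {g : (𝔼 m) → ℝ} (hg : Continuous g) :
    Integrable (fun z => g z * psi (k + 1) z) :=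
  (hg.mul (psi_continuous _)).integrable_of_hasCompactSupport (psi_compact k).mul_left

lemma contDiff_partial {m : ℕ} {n : ℕ} {u : (𝔼 m) → ℝ} (hu : ContDiff ℝ (n + 1) u) (v : 𝔼 m) :
    ContDiff ℝ n (fun y => fderiv ℝ u y v) :=
  (hu.fderiv_right le_rfl).clm_apply contDiff_const

lemma contDiff_lap {m : ℕ} {n : ℕ} {u : (𝔼 m) → ℝ} (hu : ContDiff ℝ (n + 2) u) :
    ContDiff ℝ n (lap u) := by
  unfold lap
  refine ContDiff.sum fun i _ => ?_
  refine contDiff_partial (contDiff_partial (n := n + 1) ?_ _) _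
  convert hu using 1
  push_cast
  rw [add_assoc]; norm_num

lemma fderiv_comp_aff {m : ℕ} {g : (𝔼 m) → ℝ} (hg : Differentiable ℝ g) (x : 𝔼 m) (r : ℝ)
    (z v : 𝔼 m) : fderiv ℝ (fun z => g (x + r • z)) z v = r * fderiv ℝ g (x + r • z) v := by
  have h1 : HasFDerivAt (fun z : 𝔼 m => x + r • z) (r • ContinuousLinearMap.id ℝ (𝔼 m)) z :=
    ((hasFDerivAt_id z).const_smul r).const_add x
  have h2 := (hg (x + r • z)).hasFDerivAt.comp z h1
  have h3 : fderiv ℝ (fun z => g (x + r • z)) z = _ := h2.fderiv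
  rw [h3]; simp

lemma sum_ibp {m : ℕ} (k : ℕ) {u : (𝔼 m) → ℝ} (hu : ContDiff ℝ 2 u) (x : 𝔼 m) (r : ℝ) :
    ∫ z, fderiv ℝ u (x + r • z) z * psi (k + 1) z
      = r / (2 * (k + 2)) * ∫ z, lap u (x + r • z) * psi (k + 2) z := by
  have hp : ∀ i : Fin m, ContDiff ℝ 1
      (fun y => fderiv ℝ u y (EuclideanSpace.single i 1)) := fun i =>
    contDiff_partial (n := 1) (by norm_num; exact hu) _
  have hpp : ∀ i : Fin m, Continuous (fun y =>
      fderiv ℝ (fun y => fderiv ℝ u y (EuclideanSpace.single i 1)) y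
        (EuclideanSpace.single i 1)) := fun i =>
    (contDiff_partial (n := 0) (by simpa using hp i) _).continuous
  have haff : Continuous fun z : 𝔼 m => x + r • z := by fun_prop
  have hL : ∀ z : 𝔼 m, fderiv ℝ u (x + r • z) z * psi (k + 1) z
      = ∑ i : Fin m, (fderiv ℝ u (x + r • z) (EuclideanSpace.single i 1) * z i)
          * psi (k + 1) z := by
    intro z
    rw [← Finset.sum_mul]
    congr 1
    have hz : z = ∑ i : Fin m, z i • EuclideanSpace.single i (1 : ℝ) := by
      ext j; simp [Pi.single_apply]
    conv_lhs => rw [show fderiv ℝ u (x + r • z) z = fderiv ℝ u (x + r • z)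
      (∑ i : Fin m, z i • EuclideanSpace.single i (1 : ℝ)) by rw [← hz]]
    rw [map_sum]
    refine Finset.sum_congr rfl fun i _ => ?_
    rw [map_smul, smul_eq_mul, mul_comm]
  have hR : ∀ z : 𝔼 m, lap u (x + r • z) * psi (k + 2) z
      = ∑ i : Fin m, fderiv ℝ (fun y => fderiv ℝ u y (EuclideanSpace.single i 1)) (x + r • z)
        (EuclideanSpace.single i 1) * psi (k + 2) z := by
    intro z
    rw [← Finset.sum_mul]; rfl
  simp_rw [hL, hR]
  have hzi : ∀ i : Fin m, Continuous fun z : 𝔼 m => z i := fun i => by fun_prop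
  rw [integral_finsetSum _ fun i _ => integrable_mul_psi k
      (g := fun z => fderiv ℝ u (x + r • z) (EuclideanSpace.single i 1) * z i)
      (((hp i).continuous.comp haff).mul (hzi i)),
    integral_finsetSum _ fun i _ => integrable_mul_psi (k + 1)
      (g := fun z => fderiv ℝ (fun y => fderiv ℝ u y (EuclideanSpace.single i 1)) (x + r • z)
        (EuclideanSpace.single i 1)) ((hpp i).comp haff),
    Finset.mul_sum]
  refine Finset.sum_congr rfl fun i _ => ?_
  have hd := (hp i).differentiable (by norm_num)
  have key := integral_mul_fderiv_eq_neg_fderiv_mul_of_integrable (μ := volume)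
    (f := fun z : 𝔼 m => fderiv ℝ u (x + r • z) (EuclideanSpace.single i 1))
    (g := psi (k + 2)) (v := EuclideanSpace.single i 1)
    (by
      simp_rw [fderiv_comp_aff hd]
      exact integrable_mul_psi (k + 1) (continuous_const.mul ((hpp i).comp haff)))
    (by
      simp_rw [psi_fderiv]
      have := integrable_mul_psi k (((hp i).continuous.comp haff).mul
        ((hzi i).mul (continuous_const (y := (-(2 * ((k : ℝ) + 2)))))))
      refine this.congr (Filter.Eventually.of_forall fun z => ?_)
      simp only [Pi.mul_apply, Function.comp_apply]; ring)
    (integrable_mul_psi (k + 1) ((hp i).continuous.comp haff))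
    (fun z _ => (hd.comp (by fun_prop : Differentiable ℝ fun z : 𝔼 m => x + r • z)) z)
    (fun z _ => (psi_hasFDerivAt k z).differentiableAt)
  simp_rw [fderiv_comp_aff hd, psi_fderiv] at key
  have e1 : ∀ z : 𝔼 m, fderiv ℝ u (x + r • z) (EuclideanSpace.single i 1)
      * (-(2 * ((k : ℝ) + 2)) * (z i * psi (k + 1) z))
      = -(2 * ((k : ℝ) + 2)) *
        (fderiv ℝ u (x + r • z) (EuclideanSpace.single i 1) * z i * psi (k + 1) z) := by
    intro z; ring
  simp_rw [e1, mul_assoc r] at key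
  rw [integral_const_mul, integral_const_mul] at key
  have hk : (2 * ((k : ℝ) + 2)) ≠ 0 := by positivity
  field_simp
  linarith

lemma hasDerivAt_avg {m : ℕ} (k : ℕ) {u : (𝔼 m) → ℝ} (hu : ContDiff ℝ 2 u) (x : 𝔼 m) (r : ℝ) :
    HasDerivAt (fun r : ℝ => ∫ z, u (x + r • z) * psi (k + 1) z)
      (r / (2 * (k + 2)) * ∫ z, lap u (x + r • z) * psi (k + 2) z) r := by
  rw [← sum_ibp k hu]
  have hfc : Continuous (fderiv ℝ u) := hu.continuous_fderiv (by norm_num)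
  have hF' : Continuous fun p : ℝ × (𝔼 m) => fderiv ℝ u (x + p.1 • p.2) p.2 := by fun_prop
  obtain ⟨C, hC⟩ := ((isCompact_closedBall r 1).prod
    (isCompact_closedBall (0 : 𝔼 m) 1)).exists_bound_of_continuousOn hF'.continuousOn
  have hcont : ∀ s : ℝ, Continuous fun z : 𝔼 m => u (x + s • z) := fun s =>
    hu.continuous.comp (by fun_prop)
  refine (hasDerivAt_integral_of_dominated_loc_of_deriv_le (μ := volume)
    (F := fun s z => u (x + s • z) * psi (k + 1) z)
    (F' := fun s z => fderiv ℝ u (x + s • z) z * psi (k + 1) z)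
    (bound := fun z => C * psi (k + 1) z) (closedBall_mem_nhds r one_pos) ?_ ?_ ?_ ?_ ?_ ?_).2
  · exact Filter.Eventually.of_forall fun s =>
      (integrable_mul_psi k (hcont s)).aestronglyMeasurable
  · exact integrable_mul_psi k (hcont r)
  · exact (integrable_mul_psi k (g := fun z => fderiv ℝ u (x + r • z) z)
      (hF'.comp (by fun_prop : Continuous fun z : 𝔼 m => (r, z)))).aestronglyMeasurable
  · refine Filter.Eventually.of_forall fun z s hs => ?_
    rw [norm_mul, norm_of_nonneg (psi_nonneg _ z)]
    by_cases hz : ‖z‖ ≤ 1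
    · exact mul_le_mul_of_nonneg_right
        (hC (s, z) ⟨hs, by simpa using hz⟩) (psi_nonneg _ z)
    · rw [psi_zero_of k z (not_le.1 hz).le]; simp
  · exact integrable_mul_psi k continuous_const
  · refine Filter.Eventually.of_forall fun z s _ => ?_
    have h1 : HasDerivAt (fun s : ℝ => x + s • z) z s := by
      simpa using ((hasDerivAt_id s).smul_const z).const_add x
    exact ((hu.differentiable (by norm_num) (x + s • z)).hasFDerivAt.comp_hasDerivAt s
      h1).mul_const _

lemma avg_harmonic {m : ℕ} (k : ℕ) {u : (𝔼 m) → ℝ} (hu : ContDiff ℝ 2 u)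
    (h0 : ∀ x, lap u x = 0) (x : 𝔼 m) (r : ℝ) :
    ∫ z, u (x + r • z) * psi (k + 1) z = u x * ∫ z : 𝔼 m, psi (k + 1) z := by
  have hd := hasDerivAt_avg k hu x
  simp only [h0, zero_mul, integral_zero, mul_zero] at hd
  have := is_const_of_deriv_eq_zero (fun s => (hd s).differentiableAt)
    (fun s => (hd s).deriv) r 0
  simpa [integral_const_mul] using this

lemma avg_biharmonic {m : ℕ} {u : (𝔼 m) → ℝ} (hu : ContDiff ℝ 4 u)
    (h0 : ∀ x, lap (lap u) x = 0) (x : 𝔼 m) (r : ℝ) :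
    ∫ z, u (x + r • z) * psi 1 z = u x * (∫ z : 𝔼 m, psi 1 z)
      + r ^ 2 * (lap u x * (∫ z : 𝔼 m, psi 2 z) / 8) := by
  have hl : ContDiff ℝ 2 (lap u) := contDiff_lap (n := 2) (by norm_num; exact hu)
  have hd : ∀ s : ℝ, HasDerivAt (fun r : ℝ => (∫ z, u (x + r • z) * psi 1 z)
      - r ^ 2 * (lap u x * (∫ z : 𝔼 m, psi 2 z) / 8)) 0 s := by
    intro s
    have h1 := hasDerivAt_avg 0 (hu.of_le (by norm_num)) x s
    have h2 := avg_harmonic 1 hl h0 x s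
    norm_num at h1 h2
    rw [h2] at h1
    have h3 := h1.sub ((hasDerivAt_pow 2 s).mul_const (lap u x * (∫ z : 𝔼 m, psi 2 z) / 8))
    refine h3.congr_deriv ?_
    push_cast; ring
  have := is_const_of_deriv_eq_zero (fun s => (hd s).differentiableAt)
    (fun s => (hd s).deriv) r 0
  simp [integral_const_mul] at this
  linarith

lemma avg_bound {m : ℕ} {u : (𝔼 m) → ℝ} (M : ℝ) (hbdd : ∀ x, |u x| ≤ M) (x : 𝔼 m) (r : ℝ) :
    |∫ z, u (x + r • z) * psi 1 z| ≤ M * ∫ z : 𝔼 m, psi 1 z := by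
  rw [← integral_const_mul, ← Real.norm_eq_abs]
  refine norm_integral_le_of_norm_le (integrable_mul_psi 0 continuous_const)
    (Filter.Eventually.of_forall fun z => ?_)
  rw [norm_mul, norm_of_nonneg (psi_nonneg _ z)]
  exact mul_le_mul_of_nonneg_right (hbdd _) (psi_nonneg _ z)

lemma lap_zero {m : ℕ} {u : (𝔼 m) → ℝ} (hu : ContDiff ℝ 4 u)
    (h0 : ∀ x, lap (lap u) x = 0) (M : ℝ) (hbdd : ∀ x, |u x| ≤ M) (x : 𝔼 m) : lap u x = 0 := by
  have hc1 : 0 < ∫ z : 𝔼 m, psi 1 z := psi_integral_pos 0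
  have hc2 : 0 < ∫ z : 𝔼 m, psi 2 z := psi_integral_pos 1
  by_contra hne
  set a := lap u x * (∫ z : 𝔼 m, psi 2 z) / 8 with ha
  have ha0 : 0 < |a| := abs_pos.2 (by rw [ha]; positivity)
  set c := ∫ z : 𝔼 m, psi 1 z
  have hM : 0 ≤ M := (abs_nonneg _).trans (hbdd x)
  have hb : ∀ r : ℝ, r ^ 2 * |a| ≤ 2 * (M * c) := by
    intro r
    have h1 := avg_bound M hbdd x r
    rw [avg_biharmonic hu h0] at h1
    change |u x * c + r ^ 2 * a| ≤ M * c at h1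
    have h2 : |u x * c| ≤ M * c := by
      rw [abs_mul, abs_of_pos hc1]; exact mul_le_mul_of_nonneg_right (hbdd x) hc1.le
    have h3 : r ^ 2 * |a| = |r ^ 2 * a| := by rw [abs_mul, abs_of_nonneg (sq_nonneg r)]
    rw [h3]
    rw [abs_le] at h1 h2 ⊢
    constructor <;> linarith
  have h4 := hb (√((2 * (M * c) + 1) / |a|))
  rw [Real.sq_sqrt (by positivity), div_mul_cancel₀ _ ha0.ne'] at h4
  linarith

lemma harmonic_const {m : ℕ} {u : (𝔼 m) → ℝ} (hu : ContDiff ℝ 2 u)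
    (h0 : ∀ x, lap u x = 0) (M : ℝ) (hbdd : ∀ x, |u x| ≤ M) (x y : 𝔼 m) : u x = u y := by
  have hc : 0 < ∫ z : 𝔼 m, psi 1 z := psi_integral_pos 0
  have hM : 0 ≤ M := (abs_nonneg _).trans (hbdd x)
  have hcont : ∀ (x : 𝔼 m) (s : ℝ), Continuous fun z : 𝔼 m => u (x + s • z) := fun x s =>
    hu.continuous.comp (by fun_prop)
  -- rewrite the difference as one integral
  have key : ∀ n : ℕ, (u y - u x) * (∫ z : 𝔼 m, psi 1 z)
      = ∫ z, u (x + ((n : ℝ) + 1) • z) *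
        (psi 1 (z - ((n : ℝ) + 1)⁻¹ • (y - x)) - psi 1 z) := by
    intro n
    have hn : ((n : ℝ) + 1) ≠ 0 := by positivity
    rw [sub_mul, ← avg_harmonic 0 hu h0 x ((n : ℝ) + 1), ← avg_harmonic 0 hu h0 y ((n : ℝ) + 1)]
    have e : ∀ z : 𝔼 m, y + ((n : ℝ) + 1) • (z - ((n : ℝ) + 1)⁻¹ • (y - x))
        = x + ((n : ℝ) + 1) • z := by
      intro z
      rw [smul_sub, smul_inv_smul₀ hn]; abel
    have hi := (integrable_mul_psi 0 (hcont y ((n : ℝ) + 1))).comp_sub_right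
      (((n : ℝ) + 1)⁻¹ • (y - x))
    rw [← integral_sub_right_eq_self (fun z => u (y + ((n : ℝ) + 1) • z) * psi (0 + 1) z)
      (((n : ℝ) + 1)⁻¹ • (y - x)), ← integral_sub hi
      (integrable_mul_psi 0 (hcont x ((n : ℝ) + 1)))]
    refine integral_congr_ae (Filter.Eventually.of_forall fun z => ?_)
    simp only [e, zero_add]
    ring
  have hinv : Filter.Tendsto (fun n : ℕ => ((n : ℝ) + 1)⁻¹) Filter.atTop (nhds 0) := by
    simpa using tendsto_one_div_add_atTop_nhds_zero_nat (𝕜 := ℝ)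
  have hinv1 : ∀ n : ℕ, ((n : ℝ) + 1)⁻¹ ≤ 1 := fun n => by
    apply inv_le_one_of_one_le₀; linarith [(Nat.cast_nonneg n : (0 : ℝ) ≤ n)]
  have hpsi1 : ∀ z : 𝔼 m, psi 1 z ≤ 1 := fun z => by
    simp only [psi, pow_one]; exact max_le (by nlinarith [sq_nonneg ‖z‖]) zero_le_one
  set R := 1 + ‖y - x‖ with hR
  have hlim : Filter.Tendsto (fun n : ℕ => ∫ z, u (x + ((n : ℝ) + 1) • z) *
        (psi 1 (z - ((n : ℝ) + 1)⁻¹ • (y - x)) - psi 1 z)) Filter.atTop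
        (nhds (∫ _ : 𝔼 m, (0 : ℝ))) := by
    refine tendsto_integral_of_dominated_convergence
      ((closedBall (0 : 𝔼 m) R).indicator fun _ => M * 1) ?_ ?_ ?_ ?_
    · intro n
      exact ((hcont x _).mul (((psi_continuous 1).comp
        (by fun_prop)).sub (psi_continuous 1))).aestronglyMeasurable
    · rw [integrable_indicator_iff measurableSet_closedBall]
      exact integrableOn_const (isCompact_closedBall _ _).measure_lt_top.ne
    · intro n
      refine Filter.Eventually.of_forall fun z => ?_
      by_cases hz : z ∈ closedBall (0 : 𝔼 m) R
      · rw [Set.indicator_of_mem hz, norm_mul]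
        refine mul_le_mul (hbdd _) ?_ (norm_nonneg _) hM
        rw [Real.norm_eq_abs, abs_le]
        constructor <;> linarith [hpsi1 z, hpsi1 (z - ((n : ℝ) + 1)⁻¹ • (y - x)), psi_nonneg 1 z,
          psi_nonneg 1 (z - ((n : ℝ) + 1)⁻¹ • (y - x))]
      · rw [Set.indicator_of_notMem hz]
        simp only [mem_closedBall, dist_zero_right, not_le] at hz
        have h1 : ‖((n : ℝ) + 1)⁻¹ • (y - x)‖ ≤ ‖y - x‖ := by
          rw [norm_smul, norm_of_nonneg (by positivity)]
          exact mul_le_of_le_one_left (norm_nonneg _) (hinv1 n)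
        have h2 := norm_sub_norm_le z (((n : ℝ) + 1)⁻¹ • (y - x))
        rw [psi_zero_of 0 z (by linarith [norm_nonneg (y - x)]), psi_zero_of 0 _ (by linarith)]
        simp
    · refine Filter.Eventually.of_forall fun z => ?_
      have h1 : Filter.Tendsto (fun n : ℕ => psi 1 (z - ((n : ℝ) + 1)⁻¹ • (y - x)) - psi 1 z)
          Filter.atTop (nhds 0) := by
        have hc : Continuous fun t : ℝ => psi 1 (z - t • (y - x)) - psi 1 z :=
          ((psi_continuous 1).comp (by fun_prop)).sub continuous_const
        have := (hc.tendsto 0).comp hinv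
        simpa [Function.comp_def] using this
      refine squeeze_zero_norm (a := fun n : ℕ =>
        M * ‖psi 1 (z - ((n : ℝ) + 1)⁻¹ • (y - x)) - psi 1 z‖) (fun n => ?_) ?_
      · rw [norm_mul]
        exact mul_le_mul_of_nonneg_right (hbdd _) (norm_nonneg _)
      · simpa using h1.norm.const_mul M
  simp_rw [← key] at hlim
  have := tendsto_nhds_unique hlim tendsto_const_nhds
  simp only [integral_zero] at this
  rcases mul_eq_zero.1 this.symm with h | h
  · linarith
  · exact absurd h hc.ne'

theorem liouville_biharmonic {m : ℕ} (hm : 2 ≤ m)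
    (u : EuclideanSpace ℝ (Fin m) → ℝ) (hreg : ContDiff ℝ 4 u)
    (hbih : ∀ x, lap (lap u) x = 0) (M : ℝ) (hbdd : ∀ x, |u x| ≤ M) :
    ∀ x y, u x = u y := by
  intro x y
  exact harmonic_const (hreg.of_le (by norm_num)) (lap_zero hreg hbih M hbdd) M hbdd x y
end
end
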